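/- Assume there is a constant c₀ > 0 with diam(γ) ≤ e^{c₀H(γ)} for every γ ∈ 𝒞, and assume Hypothesis (H3) with constants β₀′, c₂ > 0. Then for every k ≥ 2 there exists β₀ = β₀(α,k) > 0 such that for every β ≥ β₀ and every k-tuple (γ₁,…,γ_k) of pairwise positively compatible M-contours, Σ_{γ∈𝒞 : γ positively compatible with every γ_i} e^{−βH(γ)}·Π_{i=1}^k Φ(γ,γ_i) ≤ (16^{αk}·α/(α−1))·e^{−c₂β/4}·Σ_{φ∈S_k} H(γ_{φ(k)})·Π_{i=1}^{k−1} Φ(γ_{φ(i)},γ_{φ(i+1)}). -/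

import Mathlib

open scoped Classical BigOperators ENNReal

noncomputable section

/-- The long-range coupling `J(x,y) = |x-y|^(-α)` for `x ≠ y`, `J(x,x) = 0`. -/
def J (α : ℝ) (x y : ℤ) : ℝ := if x = y then 0 else |(x : ℝ) - (y : ℝ)| ^ (-α)

lemma J_symm (α : ℝ) (x y : ℤ) : J α x y = J α y x := by
  unfold J
  rcases eq_or_ne x y with h | h
  · simp [h]
  · rw [if_neg h, if_neg (Ne.symm h), abs_sub_comm]

/-- `H(A) = Σ_{x∈A, y∉A} 2 J(x,y)` for a set `A ⊆ ℤ`. -/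
def HamSet (α : ℝ) (A : Set ℤ) : ℝ :=
  ∑' p : ℤ × ℤ, if p.1 ∈ A ∧ p.2 ∉ A then 2 * J α p.1 p.2 else 0

/-- `H(A)` for a finite set `A`. -/
def Ham (α : ℝ) (A : Finset ℤ) : ℝ := HamSet α ↑A

/-- `Φ(A,B) = Σ_{x∈A, y∈B} 4 J(x,y)`. -/
def PhiSet (α : ℝ) (A B : Set ℤ) : ℝ :=
  ∑' p : ℤ × ℤ, if p.1 ∈ A ∧ p.2 ∈ B then 4 * J α p.1 p.2 else 0

lemma PhiSet_symm (α : ℝ) (A B : Set ℤ) : PhiSet α A B = PhiSet α B A := by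
  unfold PhiSet
  rw [← (Equiv.prodComm ℤ ℤ).tsum_eq
    (fun p : ℤ × ℤ => if p.1 ∈ B ∧ p.2 ∈ A then 4 * J α p.1 p.2 else 0)]
  apply tsum_congr
  intro p
  by_cases h : p.1 ∈ A ∧ p.2 ∈ B
  · rw [if_pos h, Equiv.prodComm_apply]
    simp only [Prod.fst_swap, Prod.snd_swap]
    rw [if_pos ⟨h.2, h.1⟩, J_symm]
  · rw [if_neg h, Equiv.prodComm_apply]
    simp only [Prod.fst_swap, Prod.snd_swap]
    rw [if_neg (by tauto)]

/-- distance between two finite sets of (dual) sites; junk value `0` if either is empty. -/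
def fdist (γ₁ γ₂ : Finset ℤ) : ℝ :=
  if h : (γ₁ ×ˢ γ₂).Nonempty then
    ((γ₁ ×ˢ γ₂).image fun p => |(p.1 : ℝ) - (p.2 : ℝ)|).min' (h.image _)
  else 0

/-- diameter of a finite set of (dual) sites; junk value `0` if empty. -/
def fdiam (γ : Finset ℤ) : ℝ :=
  if h : (γ ×ˢ γ).Nonempty then
    ((γ ×ˢ γ).image fun p => |(p.1 : ℝ) - (p.2 : ℝ)|).max' (h.image _)
  else 0

/-- Minus interior of a collection of spin flips.  We index the dual lattice
`ℤ* = ℤ + 1/2` by `ℤ`, the dual site `b : ℤ` standing for `b + 1/2`; a dual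
site `b + 1/2` is larger than `x : ℤ` iff `x ≤ b`. -/
def minusI (γ : Finset ℤ) : Set ℤ := {x : ℤ | Odd (γ.filter fun b => x ≤ b).card}

/-- A partition of `γ` into nonempty parts of even cardinality. -/
def IsEvenPartition (P : Finset (Finset ℤ)) (γ : Finset ℤ) : Prop :=
  (∀ p ∈ P, p.Nonempty ∧ Even p.card) ∧
  (P : Set (Finset ℤ)).PairwiseDisjoint id ∧ P.biUnion id = γ

/-- `γ` is an `M`-contour. -/
def IsContour (M : ℝ) (γ : Finset ℤ) : Prop :=
  γ.Nonempty ∧ Even γ.card ∧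
  ∀ P : Finset (Finset ℤ), IsEvenPartition P γ → 2 ≤ P.card →
    ∃ γ₁ ∈ P, ∃ γ₂ ∈ P, γ₁ ≠ γ₂ ∧
      fdist γ₁ γ₂ ≤ M * min (fdiam γ₁) (fdiam γ₂) ^ ((3 : ℝ) / 2)

/-- Compatibility of (distinct) contours. -/
def Compat (M : ℝ) (γ₁ γ₂ : Finset ℤ) : Prop :=
  γ₁ ≠ γ₂ ∧ M * min (fdiam γ₁) (fdiam γ₂) ^ ((3 : ℝ) / 2) < fdist γ₁ γ₂

/-- Positive compatibility of contours. -/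
def PosCompat (M : ℝ) (γ₁ γ₂ : Finset ℤ) : Prop :=
  Compat M γ₁ γ₂ ∧ Disjoint (minusI γ₁) (minusI γ₂)

/-- `Γ` is an `M`-partition of `σ`. -/
def IsMPartitionOf (M : ℝ) (Γ : Finset (Finset ℤ)) (σ : Finset ℤ) : Prop :=
  (∀ γ ∈ Γ, IsContour M γ) ∧ (Γ : Set (Finset ℤ)).PairwiseDisjoint id ∧
  Γ.biUnion id = σ ∧ ∀ γ₁ ∈ Γ, ∀ γ₂ ∈ Γ, γ₁ ≠ γ₂ → Compat M γ₁ γ₂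

/-- `Γ` is an `M`-partition (of some nonempty `σ* ∈ Ω*`). -/
def IsMPartition (M : ℝ) (Γ : Finset (Finset ℤ)) : Prop :=
  Γ.Nonempty ∧ IsMPartitionOf M Γ (Γ.biUnion id)

/-- A polymer: an `M`-partition with pairwise positively compatible contours. -/
def IsPolymer (M : ℝ) (Γ : Finset (Finset ℤ)) : Prop :=
  IsMPartition M Γ ∧ ∀ γ₁ ∈ Γ, ∀ γ₂ ∈ Γ, γ₁ ≠ γ₂ → PosCompat M γ₁ γ₂

/-- Minus interior of a collection `Γ` of contours. -/
def minusISet (Γ : Finset (Finset ℤ)) : Set ℤ := minusI (Γ.biUnion id)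

/-- `H` of a single contour. -/
def Hcont (α : ℝ) (γ : Finset ℤ) : ℝ := HamSet α (minusI γ)

/-- `H` of a collection of contours. -/
def HamPart (α : ℝ) (Γ : Finset (Finset ℤ)) : ℝ := HamSet α (minusISet Γ)

/-- The external contours `∂Γ`. -/
def extC (Γ : Finset (Finset ℤ)) : Finset (Finset ℤ) :=
  Γ.filter fun γ => ∀ γ' ∈ Γ, γ' ≠ γ →
    (minusI γ' ⊆ minusI γ ∨ Disjoint (minusI γ') (minusI γ))

/-- `ι_{γ₀}(Γ)`. -/
def iota (γ₀ : Finset ℤ) (Γ : Finset (Finset ℤ)) : Finset (Finset ℤ) :=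
  insert γ₀ ((Γ.erase γ₀).filter fun γ => minusI γ ⊆ minusI γ₀)

/-- `ι*_{γ₀}(Γ)`. -/
def iotaStar (γ₀ : Finset ℤ) (Γ : Finset (Finset ℤ)) : Finset (Finset ℤ) :=
  (iota γ₀ Γ).erase γ₀


lemma J_nonneg' (α : ℝ) (x y : ℤ) : 0 ≤ J α x y := by
  unfold J; split_ifs
  · exact le_rfl
  · positivity

/-- comparison of couplings: if `|a-b| ≤ K |x-y|` then `J x y ≤ K^α J a b`. -/
lemma J_le_of_dist (α : ℝ) (hα : 0 < α) (K : ℝ) (hK : 0 < K) (x y a b : ℤ) (hab : a ≠ b)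
    (hxy : x ≠ y)
    (h : |(a : ℝ) - b| ≤ K * |(x : ℝ) - y|) : J α x y ≤ K ^ α * J α a b := by
  unfold J
  rw [if_neg hxy, if_neg hab]
  have hd : 0 < |(a : ℝ) - b| := abs_pos.mpr (sub_ne_zero.mpr (by exact_mod_cast hab))
  have hd' : 0 < |(x : ℝ) - y| := abs_pos.mpr (sub_ne_zero.mpr (by exact_mod_cast hxy))
  rw [Real.rpow_neg hd'.le, Real.rpow_neg hd.le, ← div_eq_mul_inv, inv_eq_one_div,
    div_le_div_iff₀ (by positivity) (by positivity), one_mul,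
    ← Real.mul_rpow hK.le hd'.le]
  exact Real.rpow_le_rpow hd.le h hα.le

lemma summable_J (α : ℝ) (hα : 1 < α) (x : ℤ) : Summable (fun y => J α x y) := by
  have h := Real.summable_abs_int_rpow hα
  have h2 : Summable (fun y : ℤ => |((x - y : ℤ) : ℝ)| ^ (-α)) :=
    (Equiv.summable_iff (Equiv.subLeft x)).mpr h
  refine Summable.of_nonneg_of_le (fun y => J_nonneg' α x y) (fun y => ?_) h2
  unfold J; split_ifs
  · positivity
  · push_cast; exact le_rfl

lemma summable_Ham (α : ℝ) (hα : 1 < α) (A : Finset ℤ) :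
    Summable (fun p : ℤ × ℤ => if p.1 ∈ (A : Set ℤ) ∧ p.2 ∉ (A : Set ℤ)
      then 2 * J α p.1 p.2 else 0) := by
  have hnn : ∀ p : ℤ × ℤ, 0 ≤ (if p.1 ∈ A then 2 * J α p.1 p.2 else 0) := by
    intro p; split_ifs
    · exact mul_nonneg (by norm_num) (J_nonneg' _ _ _)
    · exact le_rfl
  have key : Summable (fun p : ℤ × ℤ => if p.1 ∈ A then 2 * J α p.1 p.2 else 0) := by
    rw [summable_prod_of_nonneg hnn]
    refine ⟨fun x => ?_, ?_⟩
    · by_cases hx : x ∈ A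
      · simpa [hx] using (summable_J α hα x).mul_left 2
      · simpa [hx] using summable_zero
    · refine summable_of_ne_finset_zero (s := A) (fun x hx => ?_)
      simp [hx]
  refine Summable.of_nonneg_of_le (fun p => ?_) (fun p => ?_) key
  · split_ifs
    · exact mul_nonneg (by norm_num) (J_nonneg' _ _ _)
    · exact le_rfl
  · by_cases h1 : p.1 ∈ A <;> by_cases h2 : p.2 ∈ A <;>
      simp [h1, h2, J_nonneg']

lemma Phi_finset (α : ℝ) (A B : Finset ℤ) :
    PhiSet α (A : Set ℤ) (B : Set ℤ) = ∑ x ∈ A, ∑ y ∈ B, 4 * J α x y := by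
  unfold PhiSet
  rw [tsum_eq_sum (s := A ×ˢ B), ← Finset.sum_product']
  · refine Finset.sum_congr rfl (fun p hp => ?_)
    have := Finset.mem_product.mp hp
    rw [if_pos (by simpa using this)]
  · intro p hp
    rw [if_neg]
    simpa using hp

lemma Ham_tsum (α : ℝ) (hα : 1 < α) (B : Finset ℤ) :
    (∑' x : ℤ, if x ∉ B then ENNReal.ofReal (∑ z ∈ B, 4 * J α x z) else 0)
      = ENNReal.ofReal (2 * HamSet α (B : Set ℤ)) := by
  have h1 : ENNReal.ofReal (2 * HamSet α (B : Set ℤ)) =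
      ∑' p : ℤ × ℤ, (if p.1 ∈ B ∧ p.2 ∉ B then ENNReal.ofReal (4 * J α p.1 p.2) else 0) := by
    unfold HamSet
    rw [← tsum_mul_left, ENNReal.ofReal_tsum_of_nonneg]
    · refine tsum_congr (fun p => ?_)
      by_cases h : p.1 ∈ B ∧ p.2 ∉ B
      · rw [if_pos h, if_pos (by simpa using h)]; ring_nf
      · rw [if_neg h, if_neg (by simpa using h)]; simp
    · intro p
      split_ifs
      · exact mul_nonneg (by norm_num) (mul_nonneg (by norm_num) (J_nonneg' _ _ _))
      · simp
    · refine Summable.mul_left 2 ?_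
      refine (summable_Ham α hα B).congr (fun p => ?_)
      congr
  rw [h1, ENNReal.tsum_prod', ENNReal.tsum_comm]
  refine tsum_congr (fun x => ?_)
  by_cases hx : x ∈ B
  · simp [hx]
  · rw [if_pos hx, ENNReal.ofReal_sum_of_nonneg
      (fun z _ => mul_nonneg (by norm_num) (J_nonneg' _ _ _)), tsum_eq_sum (s := B)]
    · refine Finset.sum_congr rfl (fun z hz => ?_)
      simp [hx, hz, J_symm α x z]
    · intro z hz; simp [hz]

/-! ### contours -/

lemma fdiam_ge (γ : Finset ℤ) (a b : ℤ) (ha : a ∈ γ) (hb : b ∈ γ) :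
    |(a : ℝ) - b| ≤ fdiam γ := by
  unfold fdiam
  have hne : (γ ×ˢ γ).Nonempty := ⟨(a, b), Finset.mem_product.mpr ⟨ha, hb⟩⟩
  rw [dif_pos hne]
  refine Finset.le_max' _ _ ?_
  rw [Finset.mem_image]
  exact ⟨(a, b), Finset.mem_product.mpr ⟨ha, hb⟩, rfl⟩

lemma minusI_sub (γ : Finset ℤ) (hne : γ.Nonempty) (hev : Even γ.card) :
    minusI γ ⊆ Set.Ioc (γ.min' hne) (γ.max' hne) := by
  intro x hx
  unfold minusI at hx
  simp only [Set.mem_ofPred_eq] at hx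
  constructor
  · by_contra h
    push Not at h
    rw [Finset.filter_true_of_mem (fun b hb => h.trans (Finset.min'_le _ _ hb))] at hx
    exact (Nat.not_odd_iff_even.mpr hev) hx
  · by_contra h
    push Not at h
    rw [Finset.filter_false_of_mem
      (fun b hb => by have := Finset.le_max' γ b hb; omega)] at hx
    simp at hx

lemma minusI_nonempty (γ : Finset ℤ) (hne : γ.Nonempty) : (minusI γ).Nonempty := by
  refine ⟨γ.max' hne, ?_⟩
  unfold minusI
  have : γ.filter (fun b => γ.max' hne ≤ b) = {γ.max' hne} := by
    ext b
    simp only [Finset.mem_filter, Finset.mem_singleton]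
    constructor
    · rintro ⟨h1, h2⟩
      exact le_antisymm (Finset.le_max' γ b h1) h2
    · rintro rfl
      exact ⟨Finset.max'_mem _ _, le_rfl⟩
  change Odd (γ.filter (fun b => γ.max' hne ≤ b)).card
  rw [this]; simp

/-- Finite minus interior and its size. -/
lemma exists_interior (γ : Finset ℤ) (hne : γ.Nonempty) (hev : Even γ.card) :
    ∃ A : Finset ℤ, (A : Set ℤ) = minusI γ ∧ A.Nonempty ∧ (A.card : ℝ) ≤ fdiam γ ∧
      ∀ x ∈ A, ∀ y ∈ A, |(x : ℝ) - y| ≤ fdiam γ := by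
  have hsub := minusI_sub γ hne hev
  have hfin : (minusI γ).Finite := (Set.finite_Ioc _ _).subset hsub
  have hd := fdiam_ge γ _ _ (γ.max'_mem hne) (γ.min'_mem hne)
  have hle : γ.min' hne ≤ γ.max' hne := Finset.min'_le _ _ (γ.max'_mem hne)
  have hd2 : ((γ.max' hne : ℤ) : ℝ) - (γ.min' hne : ℤ) ≤ fdiam γ := (le_abs_self _).trans hd
  have hmem : ∀ x ∈ hfin.toFinset, γ.min' hne < x ∧ x ≤ γ.max' hne := by
    intro x hx
    exact hsub (by simpa using hx)
  refine ⟨hfin.toFinset, by simp, by simpa using minusI_nonempty γ hne, ?_, ?_⟩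
  · have h1 : hfin.toFinset ⊆ Finset.Ioc (γ.min' hne) (γ.max' hne) := by
      intro x hx; exact Finset.mem_Ioc.mpr (hmem x hx)
    have h2 := Finset.card_le_card h1
    rw [Int.card_Ioc] at h2
    have h3 : ((hfin.toFinset.card : ℤ)) ≤ γ.max' hne - γ.min' hne := by omega
    have h4 : ((hfin.toFinset.card : ℝ)) ≤ ((γ.max' hne : ℤ) : ℝ) - (γ.min' hne : ℤ) := by
      exact_mod_cast h3
    linarith
  · intro x hx y hy
    obtain ⟨hx1, hx2⟩ := hmem x hx
    obtain ⟨hy1, hy2⟩ := hmem y hy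
    have hx1' : ((γ.min' hne : ℤ) : ℝ) < x := by exact_mod_cast hx1
    have hy1' : ((γ.min' hne : ℤ) : ℝ) < y := by exact_mod_cast hy1
    have hx2' : (x : ℝ) ≤ ((γ.max' hne : ℤ) : ℝ) := by exact_mod_cast hx2
    have hy2' : (y : ℝ) ≤ ((γ.max' hne : ℤ) : ℝ) := by exact_mod_cast hy2
    rw [abs_le]; constructor <;> linarith

/-! ### translations -/

/-- translation by `t` -/
def shE (t : ℤ) : Finset ℤ ≃ Finset ℤ := Equiv.finsetCongr (Equiv.addRight t)

lemma mem_shE (t : ℤ) (γ : Finset ℤ) (x : ℤ) : x ∈ shE t γ ↔ x - t ∈ γ := by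
  unfold shE
  simp only [Equiv.finsetCongr_apply, Finset.mem_map_equiv]
  simp [sub_eq_add_neg]

lemma card_shE (t : ℤ) (γ : Finset ℤ) : (shE t γ).card = γ.card := by
  simp [shE, Equiv.finsetCongr_apply]

lemma shE_neg (t : ℤ) (γ : Finset ℤ) : shE (-t) (shE t γ) = γ := by
  ext x; simp [mem_shE]

lemma shE_neg' (t : ℤ) (γ : Finset ℤ) : shE t (shE (-t) γ) = γ := by
  ext x; simp [mem_shE]

lemma img_shE (t : ℤ) (a b : Finset ℤ) :
    (shE t a ×ˢ shE t b).image (fun p => |(p.1 : ℝ) - (p.2 : ℝ)|) =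
      (a ×ˢ b).image (fun p => |(p.1 : ℝ) - (p.2 : ℝ)|) := by
  ext r
  simp only [Finset.mem_image, Finset.mem_product, mem_shE, Prod.exists]
  constructor
  · rintro ⟨x, y, ⟨hx, hy⟩, h⟩
    refine ⟨x - t, y - t, ⟨hx, hy⟩, ?_⟩
    rw [← h]; push_cast; ring_nf
  · rintro ⟨x, y, ⟨hx, hy⟩, h⟩
    refine ⟨x + t, y + t, ⟨by simpa using hx, by simpa using hy⟩, ?_⟩
    rw [← h]; push_cast; ring_nf

lemma ne_shE (t : ℤ) (a b : Finset ℤ) :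
    (shE t a ×ˢ shE t b).Nonempty ↔ (a ×ˢ b).Nonempty := by
  rw [← Finset.card_pos, ← Finset.card_pos, Finset.card_product, Finset.card_product,
    card_shE, card_shE]

lemma fdist_shE (t : ℤ) (a b : Finset ℤ) : fdist (shE t a) (shE t b) = fdist a b := by
  unfold fdist
  by_cases h : (a ×ˢ b).Nonempty
  · rw [dif_pos h, dif_pos ((ne_shE t a b).mpr h)]
    simp only [img_shE]
  · rw [dif_neg h, dif_neg (fun h' => h ((ne_shE t a b).mp h'))]

lemma fdiam_shE (t : ℤ) (a : Finset ℤ) : fdiam (shE t a) = fdiam a := by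
  unfold fdiam
  by_cases h : (a ×ˢ a).Nonempty
  · rw [dif_pos h, dif_pos ((ne_shE t a a).mpr h)]
    simp only [img_shE]
  · rw [dif_neg h, dif_neg (fun h' => h ((ne_shE t a a).mp h'))]

lemma mem_minusI_shE (t : ℤ) (γ : Finset ℤ) (x : ℤ) :
    x ∈ minusI (shE t γ) ↔ x - t ∈ minusI γ := by
  unfold minusI
  simp only [Set.mem_ofPred_eq]
  have : (shE t γ).filter (fun b => x ≤ b) = shE t (γ.filter (fun b => x - t ≤ b)) := by
    ext b
    simp [mem_shE]
  rw [this, card_shE]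

lemma Hcont_shE (α : ℝ) (t : ℤ) (γ : Finset ℤ) : Hcont α (shE t γ) = Hcont α γ := by
  unfold Hcont HamSet
  rw [← (Equiv.prodCongr (Equiv.subRight t) (Equiv.subRight t)).tsum_eq
    (fun p : ℤ × ℤ => if p.1 ∈ minusI γ ∧ p.2 ∉ minusI γ then 2 * J α p.1 p.2 else 0)]
  refine tsum_congr (fun p => ?_)
  have hJ : J α (p.1 - t) (p.2 - t) = J α p.1 p.2 := by
    unfold J; simp
  simp only [mem_minusI_shE, Equiv.prodCongr_apply, Prod.map_fst, Prod.map_snd,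
    Equiv.subRight_apply, hJ]

lemma IsContour_shE (M : ℝ) (t : ℤ) (γ : Finset ℤ) (h : IsContour M γ) :
    IsContour M (shE t γ) := by
  obtain ⟨hne, hev, hP⟩ := h
  have ne_iff : ∀ (s : ℤ) (p : Finset ℤ), p.Nonempty → (shE s p).Nonempty := by
    intro s p hp
    rw [← Finset.card_pos, card_shE]; exact hp.card_pos
  refine ⟨ne_iff t γ hne, by rwa [card_shE], ?_⟩
  intro P ⟨h1, h2, h3⟩ hc
  have key := hP (P.image (shE (-t))) ⟨?_, ?_, ?_⟩ ?_
  · obtain ⟨a, ha, b, hb, hab, hd⟩ := key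
    obtain ⟨a', ha', rfl⟩ := Finset.mem_image.mp ha
    obtain ⟨b', hb', rfl⟩ := Finset.mem_image.mp hb
    refine ⟨a', ha', b', hb', fun h => hab (by rw [h]), ?_⟩
    rwa [fdist_shE, fdiam_shE, fdiam_shE] at hd
  · intro p hp
    obtain ⟨p', hp', rfl⟩ := Finset.mem_image.mp hp
    exact ⟨ne_iff _ _ (h1 p' hp').1, by rw [card_shE]; exact (h1 p' hp').2⟩
  · intro a ha b hb hab
    obtain ⟨a', ha', rfl⟩ := Finset.mem_image.mp (Finset.mem_coe.mp ha)
    obtain ⟨b', hb', rfl⟩ := Finset.mem_image.mp (Finset.mem_coe.mp hb)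
    have := h2 ha' hb' (fun h => hab (by rw [h]))
    simp only [Function.onFun, id, Finset.disjoint_left, mem_shE] at this ⊢
    intro x hx; exact this hx
  · ext x
    have hx := Finset.ext_iff.mp h3 (x + t)
    simp only [Finset.mem_biUnion, id, mem_shE, Finset.mem_image, add_sub_cancel_right] at hx ⊢
    rw [← hx]
    constructor
    · rintro ⟨_, ⟨a, ha, rfl⟩, hxa⟩
      exact ⟨a, ha, by simpa [mem_shE] using hxa⟩
    · rintro ⟨a, ha, hxa⟩
      exact ⟨_, ⟨a, ha, rfl⟩, by simpa [mem_shE] using hxa⟩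
  · rw [Finset.card_image_of_injective _ (shE (-t)).injective]; exact hc

lemma h3_shift (α M : ℝ) (β : ℝ) (x : ℤ) (S : Finset ℤ → Prop)
    (hS : ∀ γ, S γ → IsContour M γ) :
    (∑' γ : {γ : Finset ℤ // S γ}, if x ∈ minusI γ.1 then
        ENNReal.ofReal (Real.exp (-β * Hcont α γ.1)) else 0) ≤
      ∑' γ : {γ : Finset ℤ // IsContour M γ ∧ (0 : ℤ) ∈ minusI γ},
        ENNReal.ofReal (Real.exp (-β * Hcont α γ.1)) := by
  have e1 := tsum_subtype {γ : Finset ℤ | S γ} (fun γ => if x ∈ minusI γ then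
        ENNReal.ofReal (Real.exp (-β * Hcont α γ)) else 0)
  have e2 := tsum_subtype {γ : Finset ℤ | IsContour M γ ∧ (0 : ℤ) ∈ minusI γ} (fun γ =>
        ENNReal.ofReal (Real.exp (-β * Hcont α γ)))
  refine (le_of_eq e1).trans (le_trans ?_ (le_of_eq e2.symm))
  rw [← (shE (-x)).tsum_eq (Set.indicator {γ : Finset ℤ | IsContour M γ ∧ (0 : ℤ) ∈ minusI γ} _)]
  refine ENNReal.tsum_le_tsum (fun γ => ?_)
  by_cases h1 : S γ
  · by_cases h2 : x ∈ minusI γ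
    · rw [Set.indicator_of_mem (by exact h1), if_pos h2, Set.indicator_of_mem, Hcont_shE]
      exact ⟨IsContour_shE M _ _ (hS γ h1), by rw [mem_minusI_shE]; simpa using h2⟩
    · rw [Set.indicator_of_mem (by exact h1), if_neg h2]; exact zero_le
  · rw [Set.indicator_of_notMem (by exact h1)]; exact zero_le

/-! ### the deterministic chain estimate -/

lemma chain_point (α : ℝ) (hα : 1 < α ∧ α ≤ 2) (m : ℕ) (x : ℤ) (y : Fin (m + 2) → ℤ)
    (hinj : Function.Injective y) (hx : ∀ i, x ≠ y i) :
    ∏ i, (4 * J α x (y i)) ≤ ∑ φ : Equiv.Perm (Fin (m + 2)),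
      (4 : ℝ) ^ (m + 1) * (4 * J α x (y (φ (Fin.last (m + 1)))) *
        ∏ i : Fin (m + 1), (4 * J α (y (φ i.castSucc)) (y (φ i.succ)))) := by
  set f : Fin (m + 2) → ℝ := fun i => -|(x : ℝ) - y i| with hf
  set φ := Tuple.sort f with hφ
  have hmono : Monotone (f ∘ φ) := Tuple.monotone_sort f
  have hnn : ∀ a b, 0 ≤ 4 * J α a b := fun a b => mul_nonneg (by norm_num) (J_nonneg' _ _ _)
  refine le_trans ?_ (Finset.single_le_sum (f := fun φ : Equiv.Perm (Fin (m + 2)) =>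
      (4 : ℝ) ^ (m + 1) * (4 * J α x (y (φ (Fin.last (m + 1)))) *
        ∏ i : Fin (m + 1), (4 * J α (y (φ i.castSucc)) (y (φ i.succ)))))
      (fun ψ _ => ?_) (Finset.mem_univ φ))
  · rw [← Equiv.prod_comp φ, Fin.prod_univ_castSucc]
    have hstep : ∏ i : Fin (m + 1), (4 * J α x (y (φ i.castSucc))) ≤
        ∏ i : Fin (m + 1), (4 * (4 * J α (y (φ i.castSucc)) (y (φ i.succ)))) := by
      refine Finset.prod_le_prod (fun i _ => hnn _ _) (fun i _ => ?_)
      have hm : f (φ i.castSucc) ≤ f (φ i.succ) := hmono (Fin.castSucc_lt_succ).le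
      have h1 : |(x : ℝ) - y (φ i.succ)| ≤ |(x : ℝ) - y (φ i.castSucc)| := by
        simp only [hf] at hm; linarith
      have h2 : |(y (φ i.castSucc) : ℝ) - y (φ i.succ)| ≤ 2 * |(x : ℝ) - y (φ i.castSucc)| := by
        have := abs_sub_le (y (φ i.castSucc) : ℝ) x (y (φ i.succ))
        rw [abs_sub_comm (y (φ i.castSucc) : ℝ) x] at this
        linarith
      have hne : y (φ i.castSucc) ≠ y (φ i.succ) := fun h =>
        (Fin.castSucc_lt_succ (i := i)).ne (φ.injective (hinj h))
      have h3 := J_le_of_dist α (by linarith) 2 (by norm_num) x (y (φ i.castSucc)) _ _ hne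
        (hx _) h2
      have h4 : (2 : ℝ) ^ α ≤ 4 := by
        calc (2 : ℝ) ^ α ≤ (2 : ℝ) ^ (2 : ℝ) :=
              Real.rpow_le_rpow_of_exponent_le (by norm_num) hα.2
          _ = 4 := by norm_num
      have h5 := mul_le_mul_of_nonneg_right h4 (J_nonneg' α (y (φ i.castSucc)) (y (φ i.succ)))
      linarith
    have hsplit : ∏ i : Fin (m + 1), (4 * (4 * J α (y (φ i.castSucc)) (y (φ i.succ)))) =
        (4 : ℝ) ^ (m + 1) * ∏ i : Fin (m + 1), (4 * J α (y (φ i.castSucc)) (y (φ i.succ))) := by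
      rw [Finset.prod_mul_distrib, Finset.prod_const, Finset.card_univ, Fintype.card_fin]
    rw [hsplit] at hstep
    refine (mul_le_mul_of_nonneg_right hstep (hnn _ _)).trans (le_of_eq ?_)
    ring
  · exact mul_nonneg (by positivity) (mul_nonneg (hnn _ _) (Finset.prod_nonneg (fun _ _ => hnn _ _)))

lemma chain_sum (α : ℝ) (m : ℕ) (x : ℤ) (B : Fin (m + 2) → Finset ℤ)
    (φ : Equiv.Perm (Fin (m + 2))) :
    ∑ y ∈ Fintype.piFinset B, (4 * J α x (y (φ (Fin.last (m + 1)))) *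
        ∏ i : Fin (m + 1), (4 * J α (y (φ i.castSucc)) (y (φ i.succ)))) ≤
      (∑ z ∈ B (φ (Fin.last (m + 1))), 4 * J α x z) *
        ∏ i : Fin (m + 1), ∑ a ∈ B (φ i.castSucc), ∑ b ∈ B (φ i.succ), 4 * J α a b := by
  have hnn : ∀ a b, 0 ≤ 4 * J α a b := fun a b => mul_nonneg (by norm_num) (J_nonneg' _ _ _)
  simp_rw [← Finset.sum_product' (f := fun a b => 4 * J α a b)]
  rw [Finset.prod_univ_sum, Finset.sum_mul_sum, ← Finset.sum_product']
  set g : (Fin (m + 2) → ℤ) → ℤ × (Fin (m + 1) → ℤ × ℤ) :=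
    fun y => (y (φ (Fin.last (m + 1))), fun i => (y (φ i.castSucc), y (φ i.succ))) with hg
  have hginj : Function.Injective g := by
    intro y y' h
    simp only [hg, Prod.mk.injEq] at h
    obtain ⟨h1, h2⟩ := h
    have : ∀ l, y (φ l) = y' (φ l) := by
      intro l
      induction l using Fin.lastCases with
      | last => exact h1
      | cast i => exact (Prod.mk.inj (congrFun h2 i)).1
    ext j
    have := this (φ.symm j)
    simpa using this
  rw [← Finset.sum_image (f := fun q : ℤ × (Fin (m + 1) → ℤ × ℤ) =>
    4 * J α x q.1 * ∏ i, (4 * J α (q.2 i).1 (q.2 i).2)) (g := g) (fun _ _ _ _ h => hginj h)]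
  refine Finset.sum_le_sum_of_subset_of_nonneg ?_ ?_
  · intro q hq
    obtain ⟨y, hy, rfl⟩ := Finset.mem_image.mp hq
    rw [Fintype.mem_piFinset] at hy
    simp only [hg, Finset.mem_product, Fintype.mem_piFinset]
    exact ⟨hy _, fun i => ⟨hy _, hy _⟩⟩
  · intro q _ _
    exact mul_nonneg (hnn _ _) (Finset.prod_nonneg (fun _ _ => hnn _ _))

lemma chain_total (α : ℝ) (hα : 1 < α ∧ α ≤ 2) (m : ℕ) (x : ℤ) (B : Fin (m + 2) → Finset ℤ)
    (hdisj : ∀ i j, i ≠ j → Disjoint (B i) (B j)) (hx : ∀ i, x ∉ B i) :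
    ∏ i, (∑ z ∈ B i, 4 * J α x z) ≤ ∑ φ : Equiv.Perm (Fin (m + 2)),
      (4 : ℝ) ^ (m + 1) * ((∑ z ∈ B (φ (Fin.last (m + 1))), 4 * J α x z) *
        ∏ i : Fin (m + 1), ∑ a ∈ B (φ i.castSucc), ∑ b ∈ B (φ i.succ), 4 * J α a b) := by
  rw [Finset.prod_univ_sum]
  calc _ ≤ ∑ y ∈ Fintype.piFinset B, ∑ φ : Equiv.Perm (Fin (m + 2)),
      (4 : ℝ) ^ (m + 1) * (4 * J α x (y (φ (Fin.last (m + 1)))) *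
        ∏ i : Fin (m + 1), (4 * J α (y (φ i.castSucc)) (y (φ i.succ)))) := by
        refine Finset.sum_le_sum (fun y hy => ?_)
        rw [Fintype.mem_piFinset] at hy
        refine chain_point α hα m x y ?_ ?_
        · intro i j hij
          by_contra hne
          exact (Finset.disjoint_left.mp (hdisj i j hne)) (hy i) (hij ▸ hy j)
        · intro i h
          exact hx i (h ▸ hy i)
    _ = _ := Finset.sum_comm
    _ ≤ _ := by
        refine Finset.sum_le_sum (fun φ _ => ?_)
        rw [← Finset.mul_sum]
        exact mul_le_mul_of_nonneg_left (chain_sum α m x B φ) (by positivity)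

/-- interaction of a finite set of diameter at most `D` with `B`, compared with one point. -/
lemma Phi_le_point (α : ℝ) (hα : 1 < α ∧ α ≤ 2) (A B : Finset ℤ) (hdisj : Disjoint A B) (D : ℝ)
    (hD : 1 ≤ D) (hcard : (A.card : ℝ) ≤ D) (hd : ∀ x ∈ A, ∀ y ∈ A, |(x : ℝ) - y| ≤ D)
    (x : ℤ) (hx : x ∈ A) :
    ∑ a ∈ A, ∑ b ∈ B, 4 * J α a b ≤ 4 * D ^ 3 * ∑ b ∈ B, 4 * J α x b := by
  have hnn : ∀ a b, 0 ≤ 4 * J α a b := fun a b => mul_nonneg (by norm_num) (J_nonneg' _ _ _)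
  have hS : 0 ≤ ∑ b ∈ B, 4 * J α x b := Finset.sum_nonneg (fun _ _ => hnn _ _)
  have h1 : ∀ a ∈ A, ∑ b ∈ B, 4 * J α a b ≤ 4 * D ^ 2 * ∑ b ∈ B, 4 * J α x b := by
    intro a ha
    rw [Finset.mul_sum]
    refine Finset.sum_le_sum (fun b hb => ?_)
    have hab : a ≠ b := fun h => Finset.disjoint_left.mp hdisj ha (h ▸ hb)
    have hxb : x ≠ b := fun h => Finset.disjoint_left.mp hdisj hx (h ▸ hb)
    have hone : 1 ≤ |(a : ℝ) - b| := by
      have : 1 ≤ |a - b| := Int.one_le_abs (sub_ne_zero.mpr hab)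
      exact_mod_cast this
    have h2 : |(x : ℝ) - b| ≤ (2 * D) * |(a : ℝ) - b| := by
      have t1 := abs_sub_le (x : ℝ) a b
      have t2 := hd x hx a ha
      nlinarith
    have h3 := J_le_of_dist α (by linarith) (2 * D) (by linarith) a b x b hxb hab h2
    have h4 : (2 * D) ^ α ≤ 4 * D ^ 2 := by
      calc (2 * D) ^ α ≤ (2 * D) ^ (2 : ℝ) :=
            Real.rpow_le_rpow_of_exponent_le (by linarith) hα.2
        _ = 4 * D ^ 2 := by rw [Real.rpow_two]; ring
    have h5 := mul_le_mul_of_nonneg_right h4 (J_nonneg' α x b)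
    linarith
  calc _ ≤ ∑ a ∈ A, 4 * D ^ 2 * ∑ b ∈ B, 4 * J α x b := Finset.sum_le_sum h1
    _ = (A.card : ℝ) * (4 * D ^ 2 * ∑ b ∈ B, 4 * J α x b) := by
      rw [Finset.sum_const, nsmul_eq_mul]
    _ ≤ D * (4 * D ^ 2 * ∑ b ∈ B, 4 * J α x b) :=
      mul_le_mul_of_nonneg_right hcard (by positivity)
    _ = _ := by ring

/-- Bound for a single contour in terms of any point of its interior. -/
lemma term_le (α M : ℝ) (hα : 1 < α ∧ α ≤ 2) (c₀ : ℝ)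
    (hdiam : ∀ γ, IsContour M γ → fdiam γ ≤ Real.exp (c₀ * Hcont α γ)) (β : ℝ) (m : ℕ)
    (B : Fin (m + 2) → Finset ℤ) (γ : Finset ℤ) (hγ : IsContour M γ)
    (hdis : ∀ i, Disjoint (minusI γ) (B i : Set ℤ)) :
    ∃ x ∈ minusI γ, Real.exp (-β * Hcont α γ) * ∏ i, PhiSet α (minusI γ) (B i : Set ℤ) ≤
      Real.exp (-(β - 3 * (m + 2) * c₀) * Hcont α γ) *
        ((4 : ℝ) ^ (m + 2) * ∏ i, ∑ z ∈ B i, 4 * J α x z) := by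
  obtain ⟨A, hA, ⟨x, hx⟩, hcard, hd⟩ := exists_interior γ hγ.1 hγ.2.1
  have hnn : ∀ a b, 0 ≤ 4 * J α a b := fun a b => mul_nonneg (by norm_num) (J_nonneg' _ _ _)
  have hD : 1 ≤ fdiam γ := by
    have : 1 ≤ A.card := Finset.card_pos.mpr ⟨x, hx⟩
    have h' : (1 : ℝ) ≤ A.card := by exact_mod_cast this
    linarith
  refine ⟨x, by rw [← hA]; exact hx, ?_⟩
  set D := fdiam γ with hDdef
  have hE := hdiam γ hγ
  have h1 : ∏ i, PhiSet α (minusI γ) (B i : Set ℤ) ≤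
      ∏ i, (4 * D ^ 3 * ∑ z ∈ B i, 4 * J α x z) := by
    refine Finset.prod_le_prod (fun i _ => ?_) (fun i _ => ?_)
    · rw [← hA, Phi_finset]
      exact Finset.sum_nonneg (fun _ _ => Finset.sum_nonneg (fun _ _ => hnn _ _))
    · rw [← hA, Phi_finset]
      refine Phi_le_point α hα A (B i) ?_ D hD hcard hd x hx
      have := hdis i
      rw [← hA] at this
      exact_mod_cast this
  have hG : 0 ≤ ∏ i, ∑ z ∈ B i, 4 * J α x z :=
    Finset.prod_nonneg (fun _ _ => Finset.sum_nonneg (fun _ _ => hnn _ _))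
  rw [Finset.prod_mul_distrib, Finset.prod_const, Finset.card_univ, Fintype.card_fin] at h1
  have h2 : (4 * D ^ 3) ^ (m + 2) ≤ 4 ^ (m + 2) * Real.exp (3 * (m + 2) * c₀ * Hcont α γ) := by
    have : Real.exp (3 * (m + 2) * c₀ * Hcont α γ) =
        (Real.exp (c₀ * Hcont α γ) ^ 3) ^ (m + 2) := by
      rw [← Real.exp_nat_mul, ← Real.exp_nat_mul]; push_cast; ring_nf
    rw [this, ← mul_pow]
    gcongr
  have h3 : Real.exp (-(β - 3 * (m + 2) * c₀) * Hcont α γ) =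
      Real.exp (-β * Hcont α γ) * Real.exp (3 * (m + 2) * c₀ * Hcont α γ) := by
    rw [← Real.exp_add]; ring_nf
  rw [h3]
  calc _ ≤ Real.exp (-β * Hcont α γ) *
        ((4 * D ^ 3) ^ (m + 2) * ∏ i, ∑ z ∈ B i, 4 * J α x z) :=
        mul_le_mul_of_nonneg_left h1 (Real.exp_pos _).le
    _ ≤ Real.exp (-β * Hcont α γ) * ((4 ^ (m + 2) * Real.exp (3 * (m + 2) * c₀ * Hcont α γ)) *
        ∏ i, ∑ z ∈ B i, 4 * J α x z) := by gcongr
    _ = _ := by ring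

/-- **Corollary (k-th contracting function for contours).**  Assume
`diam γ ≤ e^{c₀ H(γ)}` for all contours and Hypothesis (H3).  For every `k ≥ 2`
(here `k = m+2`) and `β` large, for every `k`-tuple of pairwise positively
compatible contours,
`Σ_{γ ∼⁺ all γᵢ} e^{-βH(γ)} Π_i Φ(γ,γ_i) ≤ (16^{αk} α/(α−1)) e^{-c₂β/4}
Σ_{φ∈S_k} H(γ_{φ(k)}) Π_{i=1}^{k−1} Φ(γ_{φ(i)},γ_{φ(i+1)})`. -/
theorem contour_contracting_bound (α M : ℝ) (hα : 1 < α ∧ α ≤ 2) (hM : 1 < M)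
    (c₀ : ℝ) (hc₀ : 0 < c₀)
    (hdiam : ∀ γ, IsContour M γ → fdiam γ ≤ Real.exp (c₀ * Hcont α γ))
    (β₀' c₂ : ℝ) (hβ₀' : 0 < β₀') (hc₂ : 0 < c₂)
    (h3 : ∀ β ≥ β₀',
      (∑' γ : {γ : Finset ℤ // IsContour M γ ∧ (0 : ℤ) ∈ minusI γ},
        ENNReal.ofReal (Real.exp (-β * Hcont α γ.1))) ≤
      ENNReal.ofReal (Real.exp (-c₂ * β))) :
    ∀ m : ℕ, ∃ β₀ > (0 : ℝ), ∀ β ≥ β₀, ∀ γv : Fin (m + 2) → Finset ℤ,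
      (∀ i, IsContour M (γv i)) → (∀ i j, i ≠ j → PosCompat M (γv i) (γv j)) →
      (∑' γ : {γ : Finset ℤ // IsContour M γ ∧ ∀ i, PosCompat M γ (γv i)},
        ENNReal.ofReal (Real.exp (-β * Hcont α γ.1) *
          ∏ i, PhiSet α (minusI γ.1) (minusI (γv i)))) ≤
      ENNReal.ofReal ((16 : ℝ) ^ (α * (m + 2)) * α / (α - 1) *
        Real.exp (-c₂ * β / 4) *
        ∑ φ : Equiv.Perm (Fin (m + 2)),
          Hcont α (γv (φ (Fin.last (m + 1)))) *
          ∏ i : Fin (m + 1),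
            PhiSet α (minusI (γv (φ i.castSucc))) (minusI (γv (φ i.succ)))) := by
  intro m
  set K : ℝ := 4 ^ (m + 2) * 4 ^ (m + 1) * 2 * Real.exp (c₂ * (3 * (m + 2) * c₀)) with hK
  have hKpos : 0 < K := by positivity
  refine ⟨max (β₀' + 3 * (m + 2) * c₀) (4 * Real.log K / (3 * c₂)),
    lt_of_lt_of_le (by positivity) (le_max_left _ _), ?_⟩
  intro β hβ γv hγv hcomp
  have hβ1 : β₀' + 3 * (m + 2) * c₀ ≤ β := (le_max_left _ _).trans hβ
  have hβ2 : 4 * Real.log K / (3 * c₂) ≤ β := (le_max_right _ _).trans hβ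
  set β' : ℝ := β - 3 * (m + 2) * c₀ with hβ'
  have h3' := h3 β' (by simp only [hβ', ge_iff_le]; linarith)
  have hnn : ∀ a b, 0 ≤ 4 * J α a b := fun a b => mul_nonneg (by norm_num) (J_nonneg' _ _ _)
  have hex := fun i => exists_interior (γv i) (hγv i).1 (hγv i).2.1
  choose B hB _ _ _ using hex
  have hBd : ∀ i j, i ≠ j → Disjoint (B i) (B j) := by
    intro i j hij
    have := (hcomp i j hij).2
    rw [← hB, ← hB] at this
    exact_mod_cast this
  set P : Equiv.Perm (Fin (m + 2)) → ℝ := fun φ =>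
    ∏ i : Fin (m + 1), ∑ a ∈ B (φ i.castSucc), ∑ b ∈ B (φ i.succ), 4 * J α a b with hP
  have hPnn : ∀ φ, 0 ≤ P φ := fun φ => Finset.prod_nonneg (fun _ _ =>
    Finset.sum_nonneg (fun _ _ => Finset.sum_nonneg (fun _ _ => hnn _ _)))
  have hHnn : ∀ i, 0 ≤ HamSet α (B i : Set ℤ) := by
    intro i
    unfold HamSet
    refine tsum_nonneg (fun p => ?_)
    split_ifs
    · exact mul_nonneg (by norm_num) (J_nonneg' _ _ _)
    · exact le_rfl
  set R : ℝ := ∑ φ : Equiv.Perm (Fin (m + 2)),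
    HamSet α (B (φ (Fin.last (m + 1))) : Set ℤ) * P φ with hR
  have hRnn : 0 ≤ R := Finset.sum_nonneg (fun φ _ => mul_nonneg (hHnn _) (hPnn _))
  set G : ℤ → ℝ≥0∞ := fun x => if ∀ i, x ∉ B i then
    ENNReal.ofReal ((4 : ℝ) ^ (m + 2) * ∏ i, ∑ z ∈ B i, 4 * J α x z) else 0 with hG
  -- sum of `G`
  have hGsum : ∑' x, G x ≤ ENNReal.ofReal (4 ^ (m + 2) * 4 ^ (m + 1) * 2 * R) := by
    calc ∑' x, G x ≤ ∑' x, ∑ φ : Equiv.Perm (Fin (m + 2)),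
          ENNReal.ofReal (4 ^ (m + 2) * 4 ^ (m + 1) * P φ) *
          (if x ∉ B (φ (Fin.last (m + 1))) then
            ENNReal.ofReal (∑ z ∈ B (φ (Fin.last (m + 1))), 4 * J α x z) else 0) := by
          refine ENNReal.tsum_le_tsum (fun x => ?_)
          by_cases hx : ∀ i, x ∉ B i
          · simp only [hG, if_pos hx, hx, not_false_eq_true, if_true]
            have hc := chain_total α hα m x B hBd hx
            have hc2 := mul_le_mul_of_nonneg_left hc (show (0 : ℝ) ≤ 4 ^ (m + 2) by positivity)
            refine (ENNReal.ofReal_le_ofReal hc2).trans (le_of_eq ?_)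
            rw [Finset.mul_sum, ENNReal.ofReal_sum_of_nonneg]
            · refine Finset.sum_congr rfl (fun φ _ => ?_)
              rw [← ENNReal.ofReal_mul (mul_nonneg (by positivity) (hPnn φ))]
              congr 1
              simp only [hP]; ring
            · intro φ _
              exact mul_nonneg (by positivity) (mul_nonneg (by positivity)
                (mul_nonneg (Finset.sum_nonneg (fun _ _ => hnn _ _)) (hPnn φ)))
          · simp only [hG, if_neg hx]; exact zero_le
      _ = ∑ φ : Equiv.Perm (Fin (m + 2)), ENNReal.ofReal (4 ^ (m + 2) * 4 ^ (m + 1) * P φ) *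
          ENNReal.ofReal (2 * HamSet α (B (φ (Fin.last (m + 1))) : Set ℤ)) := by
          rw [Summable.tsum_finsetSum (fun _ _ => ENNReal.summable)]
          refine Finset.sum_congr rfl (fun φ _ => ?_)
          rw [ENNReal.tsum_mul_left, Ham_tsum α hα.1]
      _ = ENNReal.ofReal (4 ^ (m + 2) * 4 ^ (m + 1) * 2 * R) := by
          rw [hR, Finset.mul_sum, ENNReal.ofReal_sum_of_nonneg]
          · refine Finset.sum_congr rfl (fun φ _ => ?_)
            rw [← ENNReal.ofReal_mul (mul_nonneg (by positivity) (hPnn φ))]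
            congr 1; ring
          · intro φ _
            exact mul_nonneg (by positivity) (mul_nonneg (hHnn _) (hPnn φ))
  -- the sum over contours
  have hmain : (∑' γ : {γ : Finset ℤ // IsContour M γ ∧ ∀ i, PosCompat M γ (γv i)},
        ENNReal.ofReal (Real.exp (-β * Hcont α γ.1) *
          ∏ i, PhiSet α (minusI γ.1) (minusI (γv i)))) ≤
      ENNReal.ofReal (Real.exp (-c₂ * β')) * ∑' x, G x := by
    calc _ ≤ ∑' γ : {γ : Finset ℤ // IsContour M γ ∧ ∀ i, PosCompat M γ (γv i)}, ∑' x : ℤ,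
          (if x ∈ minusI γ.1 then ENNReal.ofReal (Real.exp (-β' * Hcont α γ.1)) else 0) * G x := by
          refine ENNReal.tsum_le_tsum (fun γ => ?_)
          obtain ⟨γ, hγ, hγc⟩ := γ
          have hdis : ∀ i, Disjoint (minusI γ) (B i : Set ℤ) := by
            intro i; rw [hB]; exact (hγc i).2
          obtain ⟨x, hx, hle⟩ := term_le α M hα c₀ hdiam β m B γ hγ hdis
          refine le_trans ?_ (ENNReal.le_tsum x)
          have hxB : ∀ i, x ∉ B i := fun i hi =>
            Set.disjoint_left.mp (hdis i) hx (Finset.mem_coe.mpr hi)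
          simp only [hG, if_pos hx, if_pos hxB]
          rw [← ENNReal.ofReal_mul (Real.exp_pos _).le]
          simp only [hB] at hle
          exact ENNReal.ofReal_le_ofReal hle
      _ = ∑' x : ℤ, (∑' γ : {γ : Finset ℤ // IsContour M γ ∧ ∀ i, PosCompat M γ (γv i)},
          (if x ∈ minusI γ.1 then ENNReal.ofReal (Real.exp (-β' * Hcont α γ.1)) else 0)) * G x := by
          rw [ENNReal.tsum_comm]
          exact tsum_congr (fun x => ENNReal.tsum_mul_right)
      _ ≤ ∑' x : ℤ, ENNReal.ofReal (Real.exp (-c₂ * β')) * G x := by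
          refine ENNReal.tsum_le_tsum (fun x => mul_le_mul' ?_ le_rfl)
          exact (h3_shift α M β' x _ (fun γ h => h.1)).trans h3'
      _ = _ := ENNReal.tsum_mul_left
  refine hmain.trans ((mul_le_mul' le_rfl hGsum).trans ?_)
  rw [← ENNReal.ofReal_mul (Real.exp_pos _).le]
  refine ENNReal.ofReal_le_ofReal ?_
  have hRHS : (∑ φ : Equiv.Perm (Fin (m + 2)),
          Hcont α (γv (φ (Fin.last (m + 1)))) *
          ∏ i : Fin (m + 1),
            PhiSet α (minusI (γv (φ i.castSucc))) (minusI (γv (φ i.succ)))) = R := by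
    simp only [hR, hP, Hcont, ← hB, Phi_finset]
  rw [hRHS]
  have hC : 1 ≤ (16 : ℝ) ^ (α * (m + 2)) * α / (α - 1) := by
    have h1 : (1 : ℝ) ≤ (16 : ℝ) ^ (α * (m + 2)) :=
      Real.one_le_rpow (by norm_num) (mul_nonneg (by linarith) (by positivity))
    rw [le_div_iff₀ (by linarith)]
    nlinarith
  have hexp : Real.exp (-c₂ * β') * (4 ^ (m + 2) * 4 ^ (m + 1) * 2) ≤
      Real.exp (-c₂ * β / 4) := by
    have e1 : Real.exp (-c₂ * β') * (4 ^ (m + 2) * 4 ^ (m + 1) * 2) =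
        Real.exp (-c₂ * β) * K := by
      have : Real.exp (-c₂ * β') =
          Real.exp (-c₂ * β) * Real.exp (c₂ * (3 * (m + 2) * c₀)) := by
        rw [← Real.exp_add, hβ']; ring_nf
      rw [this, hK]; ring
    rw [e1, ← Real.exp_log hKpos, ← Real.exp_add, Real.exp_le_exp]
    rw [div_le_iff₀ (by positivity)] at hβ2
    linarith
  calc _ = (Real.exp (-c₂ * β') * (4 ^ (m + 2) * 4 ^ (m + 1) * 2)) * R := by ring
    _ ≤ Real.exp (-c₂ * β / 4) * R := mul_le_mul_of_nonneg_right hexp hRnn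
    _ = 1 * Real.exp (-c₂ * β / 4) * R := by ring
    _ ≤ _ := by gcongr

end
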